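/- arXiv:1107.2422 — 6 statements merged into one kernel-verified Lean document; each statement's English description precedes it below -/
import Mathlib

section
/- If v is a cover of a nonempty word w, then there exists a set P of positions at which v occurs in w, with |P| ≤ ⌊2|w|/|v|⌋, such that every position q ∈ [1..|w|] satisfies p ≤ q ≤ p+|v|−1 for some p ∈ P. -/
/-- `v` occurs at (1-indexed) position `p` in `w`. -/
def OccursAt {α : Type*} (w v : List α) (p : ℕ) : Prop :=
  1 ≤ p ∧ p + v.length ≤ w.length + 1 ∧ (w.drop (p - 1)).take v.length = v

/-- `v` is a cover of `w`: every position of `w` lies within some occurrence of `v`. -/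
def IsCover {α : Type*} (v w : List α) : Prop :=
  ∀ q, 1 ≤ q → q ≤ w.length → ∃ p, OccursAt w v p ∧ p ≤ q ∧ q ≤ p + v.length - 1

/-- If intervals of a common length `m` starting in `O` cover `[1..n]` and stay inside it, then
a subfamily with `|P| * m ≤ n * 2` already covers `[1..n]`. -/
lemma exists_subset_interval_cover (n m : ℕ) (O : Finset ℕ)
    (hO : ∀ p ∈ O, 1 ≤ p ∧ p + m ≤ n + 1)
    (hcov : ∀ q, 1 ≤ q → q ≤ n → ∃ p ∈ O, p ≤ q ∧ q < p + m) :
    ∃ P ⊆ O, P.card * m ≤ n * 2 ∧ ∀ q, 1 ≤ q → q ≤ n → ∃ p ∈ P, p ≤ q ∧ q < p + m := by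
  classical
  obtain ⟨P, hP, hmin⟩ := Finset.exists_min_image
    (O.powerset.filter fun P => ∀ q, 1 ≤ q → q ≤ n → ∃ p ∈ P, p ≤ q ∧ q < p + m)
    Finset.card ⟨O, by simpa using hcov⟩
  simp only [Finset.mem_filter, Finset.mem_powerset] at hP hmin
  obtain ⟨hPO, hPcov⟩ := hP
  -- an interval lying in the union of two overlapping neighbours would be redundant
  have no_triple : ∀ q, ∀ a ∈ P, ∀ b ∈ P, ∀ c ∈ P, a < b → b < c → c ≤ q → q < a + m →
      False := by
    intro q a ha b hb c hc hab hbc hcq hqa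
    have hle := hmin (P.erase b) ⟨(Finset.erase_subset _ _).trans hPO, by
      intro x hx hxn
      obtain ⟨p, hp, hpx, hxp⟩ := hPcov x hx hxn
      by_cases hpb : p = b
      · subst hpb
        by_cases hxc : x < c
        · exact ⟨a, Finset.mem_erase.2 ⟨by omega, ha⟩, by omega, by omega⟩
        · exact ⟨c, Finset.mem_erase.2 ⟨by omega, hc⟩, by omega, by omega⟩
      · exact ⟨p, Finset.mem_erase.2 ⟨hpb, hp⟩, hpx, hxp⟩⟩
    exact absurd (Finset.card_erase_lt_of_mem hb) (by omega)
  refine ⟨P, hPO, ?_, hPcov⟩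
  have key := Finset.card_mul_le_card_mul (s := P) (t := Finset.Icc 1 n) (m := m) (n := 2)
    (fun p q => p ≤ q ∧ q < p + m) ?_ ?_
  · simpa using key
  · intro p hp
    have hp' := hO p (hPO hp)
    have hsub : Finset.Ico p (p + m) ⊆
        Finset.bipartiteAbove (fun p q => p ≤ q ∧ q < p + m) (Finset.Icc 1 n) p := by
      intro q hq
      simp only [Finset.mem_Ico, Finset.mem_bipartiteAbove, Finset.mem_Icc] at hq ⊢
      omega
    simpa using Finset.card_le_card hsub
  · intro q _
    by_contra! hlt
    obtain ⟨a, b, c, ha, hb, hc, hab, hac, hbc⟩ := Finset.two_lt_card_iff.1 hlt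
    simp only [Finset.mem_bipartiteBelow] at ha hb hc
    have := no_triple q
    grind

theorem cover_small_occurrence_set {α : Type*} (w v : List α) (hw : w ≠ [])
    (hcov : IsCover v w) :
    ∃ P : Finset ℕ, (∀ p ∈ P, OccursAt w v p) ∧
      P.card ≤ 2 * w.length / v.length ∧
      ∀ q, 1 ≤ q → q ≤ w.length → ∃ p ∈ P, p ≤ q ∧ q ≤ p + v.length - 1 := by
  classical
  have hn : 1 ≤ w.length := List.length_pos_iff.2 hw
  have hm : 0 < v.length := by
    obtain ⟨p, ⟨hp, -, -⟩, h1, h2⟩ := hcov 1 le_rfl hn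
    omega
  obtain ⟨P, hPO, hcard, hP⟩ := exists_subset_interval_cover w.length v.length
    ((Finset.Icc 1 (w.length + 1)).filter (OccursAt w v))
    (fun p hp => by
      obtain ⟨h1, h2, -⟩ := (Finset.mem_filter.1 hp).2
      exact ⟨h1, h2⟩)
    (fun q hq hqn => by
      obtain ⟨p, hp, h1, h2⟩ := hcov q hq hqn
      have hp1 := hp.1
      exact ⟨p, Finset.mem_filter.2 ⟨Finset.mem_Icc.2 ⟨hp1, by omega⟩, hp⟩, h1, by omega⟩)
  refine ⟨P, fun p hp => (Finset.mem_filter.1 (hPO hp)).2, ?_, fun q hq hqn => ?_⟩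
  · rw [Nat.le_div_iff_mul_le hm]
    omega
  · obtain ⟨p, hp, h1, h2⟩ := hP q hq hqn
    exact ⟨p, hp, h1, by omega⟩
end

section
/- Let F be an f-factorization of w and let v be a cover of w. Then for λ = [|v|+1 .. |w|], the number of factors of F whose block of positions is contained in λ satisfies |F_λ| ≤ ⌊2|w|/|v|⌋. -/
/-- `F` is a factorization of `w`: a sequence of nonempty words concatenating to `w`,
each factor being a single letter or a factor of the concatenation of the previous ones. -/
def IsFactorization {α : Type*} (w : List α) (F : List (List α)) : Prop :=
  F.flatten = w ∧ ∀ (t : ℕ) (ht : t < F.length), F.get ⟨t, ht⟩ ≠ [] ∧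
    ((F.get ⟨t, ht⟩).length = 1 ∨ ∃ x z, x ++ F.get ⟨t, ht⟩ ++ z = (F.take t).flatten)

/-- An f-factorization: a factorization with the minimal number of factors. -/
def IsFFactorization {α : Type*} (w : List α) (F : List (List α)) : Prop :=
  IsFactorization w F ∧ ∀ G, IsFactorization w G → F.length ≤ G.length

/-- The number of factors of `F` whose block of positions is contained in `[lo..hi]`.
The block of the `t`-th factor is `[|f₁⋯f_{t-1}|+1 .. |f₁⋯f_t|]`. -/
def NumFactorsIn {α : Type*} (F : List (List α)) (lo hi : ℕ) : ℕ :=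
  ((Finset.range F.length).filter fun t =>
    lo ≤ (F.take t).flatten.length + 1 ∧ (F.take (t + 1)).flatten.length ≤ hi).card

/-- A nonempty piece of `w` that starts inside an occurrence of `v` and runs to its end is
contained in `v` as a factor. -/
theorem OccursAt.infix_piece {α : Type*} {w v : List α} {p e : ℕ} (h : OccursAt w v p)
    (hpe : p ≤ e + 1) (hep : e + 1 ≤ p + v.length - 1) :
    ∃ g : List α, g ≠ [] ∧ g <:+: v ∧ g ++ w.drop (p + v.length - 1) = w.drop e := by
  obtain ⟨h1, h2, h3⟩ := h
  refine ⟨v.drop (e + 1 - p), ?_, (List.drop_suffix _ _).isInfix, ?_⟩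
  · intro h
    have := List.drop_eq_nil_iff.mp h
    omega
  · have hv : v ++ w.drop (p + v.length - 1) = w.drop (p - 1) := by
      conv_rhs => rw [← List.take_append_drop v.length (w.drop (p - 1)), h3, List.drop_drop]
      congr 2
      omega
    have := congrArg (List.drop (e + 1 - p)) hv
    rw [List.drop_append_of_le_length (by omega), List.drop_drop] at this
    rw [this]
    congr 1
    omega

/-- Among the occurrences of a cover containing a given position there is a rightmost one. -/
theorem IsCover.exists_rightmost {α : Type*} {w v : List α} (hcov : IsCover v w) {e : ℕ}
    (he : e < w.length) :
    ∃ p, OccursAt w v p ∧ p ≤ e + 1 ∧ e + 1 ≤ p + v.length - 1 ∧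
      ∀ p', OccursAt w v p' → p' ≤ e + 1 → p' ≤ p := by
  classical
  obtain ⟨p₀, h₀, hle, hge⟩ := hcov (e + 1) (by omega) he
  have hmax : ∀ p', OccursAt w v p' → p' ≤ e + 1 →
      p' ≤ Nat.findGreatest (OccursAt w v) (e + 1) :=
    fun p' h hp => Nat.le_findGreatest hp h
  have := hmax p₀ h₀ hle
  exact ⟨_, Nat.findGreatest_spec hle h₀, Nat.findGreatest_le _, by omega, hmax⟩

/-- Every suffix of a word covered by `v` splits into few factors of `v`: two consecutive greedy
steps advance by more than `|v|`. -/
theorem IsCover.exists_pieces {α : Type*} {w v : List α} (hcov : IsCover v w) (e : ℕ)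
    (he : e ≤ w.length) :
    ∃ G : List (List α), G.flatten = w.drop e ∧ (∀ g ∈ G, g ≠ [] ∧ g <:+: v) ∧
      G.length * v.length ≤ 2 * (w.length - e) + v.length := by
  induction hd : w.length - e using Nat.strong_induction_on generalizing e with
  | _ d ih =>
    subst hd
    rcases he.eq_or_lt with rfl | hlt
    · exact ⟨[], by simp, by simp, by simp⟩
    obtain ⟨p, hp, hpe, hep, hmax⟩ := hcov.exists_rightmost hlt
    obtain ⟨g, hg, hgv, hgw⟩ := hp.infix_piece hpe hep
    have hpn := hp.2.1
    rcases (show p + v.length - 1 ≤ w.length by omega).eq_or_lt with heq | hlt'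
    · refine ⟨[g], ?_, by simp [hg, hgv], by simp⟩
      simpa [heq] using hgw
    obtain ⟨p', hp', hpe', hep', -⟩ := hcov.exists_rightmost hlt'
    obtain ⟨g', hg', hgv', hgw'⟩ := hp'.infix_piece hpe' hep'
    have hpn' := hp'.2.1
    have hadv : e + 1 < p' := by
      by_contra hcon
      have := hmax p' hp' (by omega)
      omega
    obtain ⟨G, hGw, hGv, hGl⟩ := ih _ (by omega) (p' + v.length - 1) (by omega) rfl
    refine ⟨g :: g' :: G, ?_, ?_, ?_⟩
    · simp [hGw, hgw', hgw]
    · simp only [List.mem_cons, forall_eq_or_imp]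
      exact ⟨⟨hg, hgv⟩, ⟨hg', hgv'⟩, hGv⟩
    · simp only [List.length_cons, add_mul, one_mul]
      omega

/-- A nonempty word begins with each of its covers. -/
theorem IsCover.isPrefix {α : Type*} {w v : List α} (hcov : IsCover v w) (hw : 0 < w.length) :
    v <+: w := by
  obtain ⟨p, ⟨h1, -, h3⟩, hp, -⟩ := hcov 1 le_rfl hw
  obtain rfl : p = 1 := by omega
  rw [← h3]
  simpa using List.take_prefix v.length w

/-- An initial segment of a factorization that spells a word beginning with `v` can be continued
by arbitrary nonempty factors of `v`. -/
theorem IsFactorization.take_append {α : Type*} {w v : List α} {F G : List (List α)} {s : ℕ}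
    (hF : IsFactorization w F) (hs : s ≤ F.length) (hv : v <+: (F.take s).flatten)
    (hG : ∀ g ∈ G, g ≠ [] ∧ g <:+: v) (hw : (F.take s).flatten ++ G.flatten = w) :
    IsFactorization w (F.take s ++ G) := by
  refine ⟨by simpa using hw, fun t ht => ?_⟩
  have hlen : (F.take s).length = s := by simpa using hs
  simp only [List.get_eq_getElem]
  rcases lt_or_ge t s with hts | hts
  · have := hF.2 t (by omega)
    simp only [List.get_eq_getElem] at this
    rw [List.getElem_append_left (by omega), List.getElem_take,
      List.take_append_of_le_length (by omega), List.take_take, min_eq_left hts.le]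
    exact this
  · rw [List.getElem_append_right (by omega)]
    obtain ⟨hne, hinf⟩ := hG _ (List.getElem_mem (l := G) (n := t - (F.take s).length)
      (by rw [List.length_append] at ht; omega))
    refine ⟨hne, Or.inr ?_⟩
    have hpre : v <+: ((F.take s ++ G).take t).flatten := by
      rw [List.take_append, List.take_of_length_le (by omega), List.flatten_append]
      exact hv.trans (List.prefix_append _ _)
    exact hinf.trans hpre.isInfix

theorem covers_factors {α : Type*} (w v : List α) (F : List (List α))
    (hF : IsFFactorization w F) (hcov : IsCover v w) :
    NumFactorsIn F (v.length + 1) w.length ≤ 2 * w.length / v.length := by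
  classical
  obtain ⟨hfac, hmin⟩ := hF
  rcases Nat.eq_zero_or_pos w.length with h0 | hpos
  · obtain rfl := List.length_eq_zero_iff.mp h0
    have := hmin [] ⟨rfl, by simp⟩
    obtain rfl : F = [] := by simpa using this
    simp [NumFactorsIn]
  have hvpos : 0 < v.length := by
    obtain ⟨p, ⟨h1, -, -⟩, hp, hq⟩ := hcov 1 le_rfl hpos
    omega
  have hvw := hcov.isPrefix hpos
  have hex : ∃ t, v.length ≤ (F.take t).flatten.length :=
    ⟨F.length, by rw [List.take_length, hfac.1]; exact hvw.length_le⟩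
  obtain ⟨s, hs, hsmin⟩ : ∃ s, v.length ≤ (F.take s).flatten.length ∧
      ∀ t, v.length ≤ (F.take t).flatten.length → s ≤ t :=
    ⟨Nat.find hex, Nat.find_spec hex, fun t ht => Nat.find_min' hex ht⟩
  have hsF : s ≤ F.length :=
    hsmin _ (by rw [List.take_length, hfac.1]; exact hvw.length_le)
  have hsplit : (F.take s).flatten ++ (F.drop s).flatten = w := by
    rw [← List.flatten_append, List.take_append_drop, hfac.1]
  have hpre : (F.take s).flatten <+: w := ⟨_, hsplit⟩
  obtain ⟨G, hGw, hGv, hGl⟩ := hcov.exists_pieces _ hpre.length_le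
  have hG := hmin _ (hfac.take_append hsF (List.prefix_of_prefix_length_le hvw hpre hs) hGv (by
    rw [hGw]
    nth_rewrite 1 [List.prefix_iff_eq_take.mp hpre]
    exact List.take_append_drop _ _))
  have hcount : NumFactorsIn F (v.length + 1) w.length ≤ F.length - s := by
    rw [NumFactorsIn, ← Nat.card_Ico]
    refine Finset.card_le_card fun t ht => ?_
    simp only [Finset.mem_filter, Finset.mem_range] at ht
    exact Finset.mem_Ico.mpr ⟨hsmin t (by omega), ht.1⟩
  rw [List.length_append, List.length_take, min_eq_left hsF] at hG
  rw [Nat.le_div_iff_mul_le hvpos]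
  have hle := Nat.mul_le_mul_right v.length
    (show NumFactorsIn F (v.length + 1) w.length ≤ G.length by omega)
  have := hpre.length_le
  omega
end

section
/- (Staircase-Factors Lemma) Let m ≥ 1, let S be the m-staircase covering w ∈ Σ^n, and let F be any factorization of w. Then |Reduce(S,F)| ≤ 4·(|F|−1). -/
/-- The `m`-staircase covering the interval `[i..j]`: the family of nonempty intervals
`[i+km .. i+(k+3)m−2] ∩ [i..j]` for `k = 0,…,max(0,⌈(j−i+1)/m⌉−3)`, each interval
represented as the pair of its endpoints.  (For `i = 1`, `j = n` this is the `m`-staircase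
`{[km+1 .. (k+3)m−1] ∩ [1..n]}` covering a word of length `n`.) -/
def Staircase (i j m : ℕ) : Finset (ℕ × ℕ) :=
  ((Finset.range (((j + 1 - i + m - 1) / m - 3) + 1)).image
    fun k => (i + k * m, min (i + (k + 3) * m - 2) j)).filter fun ab => ab.1 ≤ ab.2

/-- `Reduce i j m S F`: the intervals `[a..b] ∈ S` such that the extended interval
`[a .. b+m] ∩ [i..j]` is not contained in the block of positions occupied by a single
factor of the factorization `F` of `w[i..j]` (the `t`-th factor occupies the block
`[i + |f₁⋯f_{t-1}| .. i + |f₁⋯f_t| − 1]`). -/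
def Reduce {α : Type*} (i j m : ℕ) (S : Finset (ℕ × ℕ)) (F : List (List α)) :
    Finset (ℕ × ℕ) :=
  S.filter fun ab => ¬ ∃ t < F.length,
    i + (F.take t).flatten.length ≤ ab.1 ∧
      min (ab.2 + m) j + 1 ≤ i + (F.take (t + 1)).flatten.length

/-- An interval that is not contained in a single block of `F` contains a position
`|f₁⋯f_{t+1}|` at which two consecutive blocks meet, together with the next position. -/
theorem exists_boundary_of_not_subset_block {α : Type*} (F : List (List α)) {a c : ℕ}
    (ha : 1 ≤ a) (haF : a ≤ F.flatten.length) (hcF : c ≤ F.flatten.length)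
    (h : ¬ ∃ t < F.length, 1 + (F.take t).flatten.length ≤ a ∧
      c + 1 ≤ 1 + (F.take (t + 1)).flatten.length) :
    ∃ t < F.length - 1,
      a ≤ (F.take (t + 1)).flatten.length ∧ (F.take (t + 1)).flatten.length < c := by
  have hex : ∃ t, a ≤ (F.take t).flatten.length := ⟨F.length, by simpa using haF⟩
  obtain ⟨s, hs⟩ : ∃ s, Nat.find hex = s + 1 := by
    refine Nat.exists_eq_succ_of_ne_zero fun h0 => ?_
    have := Nat.find_spec hex
    rw [h0, List.take_zero, List.flatten_nil, List.length_nil] at this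
    omega
  have hspec := Nat.find_spec hex
  have hmin := Nat.find_min hex (m := s) (by omega)
  have hle : Nat.find hex ≤ F.length := Nat.find_min' hex (by simpa using haF)
  rw [hs] at hspec hle
  have hlt : (F.take (s + 1)).flatten.length < c := by
    by_contra hc
    exact h ⟨s, by omega, by omega, by omega⟩
  refine ⟨s, ?_, hspec, hlt⟩
  by_contra hK
  rw [List.take_of_length_le (by omega)] at hlt
  omega

theorem staircase_factors {α : Type*} (w : List α) (m : ℕ) (hm : 1 ≤ m)
    (F : List (List α)) (hF : IsFactorization w F) :
    (Reduce 1 w.length m (Staircase 1 w.length m) F).card ≤ 4 * (F.length - 1) := by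
  let interval : ℕ → ℕ × ℕ := fun k => (1 + k * m, min (1 + (k + 3) * m - 2) w.length)
  have hsub : Reduce 1 w.length m (Staircase 1 w.length m) F ⊆
      (Finset.range (F.length - 1)).biUnion fun t =>
        (Finset.range 4).image fun d =>
          interval (((F.take (t + 1)).flatten.length - 1) / m - d) := by
    intro ab hab
    simp only [Reduce, Staircase, Finset.mem_filter, Finset.mem_image] at hab
    obtain ⟨⟨⟨k, -, rfl⟩, hne⟩, hnot⟩ := hab
    have hlen : F.flatten.length = w.length := congrArg List.length hF.1
    dsimp only at hne hnot
    obtain ⟨t, ht, hlo, hhi⟩ := exists_boundary_of_not_subset_block F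
      (by omega) (by omega) (by omega) hnot
    set p := (F.take (t + 1)).flatten.length
    have hkq : k ≤ (p - 1) / m := (Nat.le_div_iff_mul_le hm).2 (by omega)
    have hqk : (p - 1) / m < k + 4 := by
      rw [Nat.div_lt_iff_lt_mul hm]
      have : (k + 4) * m = (k + 3) * m + m := by ring
      omega
    simp only [Finset.mem_biUnion, Finset.mem_image, Finset.mem_range]
    refine ⟨t, ht, (p - 1) / m - k, by omega, ?_⟩
    change interval ((p - 1) / m - ((p - 1) / m - k)) = interval k
    rw [Nat.sub_sub_self hkq]
  calc _ ≤ _ := Finset.card_le_card hsub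
    _ ≤ (Finset.range (F.length - 1)).card * 4 :=
      Finset.card_biUnion_le_card_mul _ _ _ fun t _ =>
        Finset.card_image_le.trans (Finset.card_range 4).le
    _ = 4 * (F.length - 1) := by rw [Finset.card_range, mul_comm]
end

section
/- (Reduction-Property Lemma, part 1) Let w ∈ Σ^n with n > 200, let Δ = ⌊n/50⌋, let F be an f-factorization of w, and let g = |F_{[2Δ+1 .. n−Δ]}| be the number of middle factors of F. If g > 0 and ⌊n/(50g)⌋ ≥ 1, then g ≥ 3. -/
/-- A factor is no longer than the prefix preceding it, unless it is a single letter. -/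
theorem IsFactorization.prefix_length_step {α : Type*} {w : List α} {F : List (List α)}
    (hF : IsFactorization w F) {t : ℕ} (ht : t < F.length) :
    (F.take t).flatten.length ≤ (F.take (t + 1)).flatten.length ∧
      ((F.take (t + 1)).flatten.length ≤ (F.take t).flatten.length + 1 ∨
        (F.take (t + 1)).flatten.length ≤ 2 * (F.take t).flatten.length) := by
  have key : (F.take (t + 1)).flatten.length =
      (F.take t).flatten.length + (F.get ⟨t, ht⟩).length := by
    rw [List.take_add_one, List.getElem?_eq_getElem ht, List.flatten_append]
    simp
  rw [key]
  refine ⟨Nat.le_add_right _ _, ?_⟩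
  rcases (hF.2 t ht).2 with h | ⟨x, z, h⟩
  · exact Or.inl (by rw [h])
  · have hlen := congrArg List.length h
    rw [List.length_append, List.length_append] at hlen
    exact Or.inr (by omega)

theorem reduction_property_part1 {α : Type*} (w : List α) (hn : 200 < w.length)
    (F : List (List α)) (hF : IsFFactorization w F) (g : ℕ)
    (hg : g = NumFactorsIn F (2 * (w.length / 50) + 1) (w.length - w.length / 50))
    (hgpos : 0 < g) (hm : 1 ≤ w.length / (50 * g)) :
    3 ≤ g := by
  have hstep := fun t (ht : t < F.length) => hF.1.prefix_length_step ht
  have hlast : (F.take F.length).flatten.length = w.length := by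
    rw [List.take_length, hF.1.1]
  have hzero : (F.take 0).flatten.length = 0 := by simp
  rw [hg, NumFactorsIn]
  generalize hP : (fun t => (F.take t).flatten.length) = P
  have hPt : ∀ t, (F.take t).flatten.length = P t := fun t => congrFun hP t
  simp only [hPt] at hstep hlast hzero ⊢
  have hex : ∃ t, 2 * (w.length / 50) ≤ P t := ⟨F.length, by omega⟩
  obtain ⟨s, hs, hmin⟩ : ∃ s, 2 * (w.length / 50) ≤ P s ∧
      ∀ t < s, P t < 2 * (w.length / 50) := by
    classical
    exact ⟨Nat.find hex, Nat.find_spec hex, fun t ht => not_le.1 (Nat.find_min hex ht)⟩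
  have hne : ∀ t, P t < w.length → t ≠ F.length := by
    rintro t ht rfl
    omega
  have hsK : s ≤ F.length := by
    by_contra! h
    have := hmin _ h
    omega
  obtain ⟨r, rfl⟩ : ∃ r, s = r + 1 := Nat.exists_eq_succ_of_ne_zero (by rintro rfl; omega)
  have hr := hmin r (Nat.lt_succ_self r)
  have h0 := hstep r (by omega)
  have k1 := hne (r + 1) (by omega)
  have h1 := hstep (r + 1) (by omega)
  have k2 := hne (r + 1 + 1) (by omega)
  have h2 := hstep (r + 1 + 1) (by omega)
  have k3 := hne (r + 1 + 1 + 1) (by omega)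
  have h3 := hstep (r + 1 + 1 + 1) (by omega)
  have hsub : Finset.Ico (r + 1) (r + 4) ⊆ (Finset.range F.length).filter fun t =>
      2 * (w.length / 50) + 1 ≤ P t + 1 ∧ P (t + 1) ≤ w.length - w.length / 50 := by
    intro t ht
    rw [Finset.mem_Ico] at ht
    rw [Finset.mem_filter, Finset.mem_range]
    obtain rfl | rfl | rfl : t = r + 1 ∨ t = r + 1 + 1 ∨ t = r + 1 + 1 + 1 := by omega
    all_goals omega
  simpa using Finset.card_le_card hsub
end

section
/- (Quasiseeds-Factors Lemma) Let F be an f-factorization of w and let v be a quasiseed of w. Then for α = [2|v|+1 .. |w|−|v|], the number of factors of F whose block of positions is contained in α satisfies |F_α| ≤ ⌊2|w|/|v|⌋. -/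
/-- `v` is a quasiseed of `w`: `v` is a factor of `w` and `w = xyz` with
`|x| < |v|`, `|z| < |v|` and `v` a cover of `y`. -/
def IsQuasiseed {α : Type*} (v w : List α) : Prop :=
  (∃ x z, w = x ++ v ++ z) ∧
  ∃ x y z, w = x ++ y ++ z ∧ x.length < v.length ∧ z.length < v.length ∧ IsCover v y

/-- `F` is a factorization of its concatenation in a context where the text `p` has already been
read: every word is nonempty, and is a single letter or a factor of the text read so far. -/
def FactorizesAfter {α : Type*} : List α → List (List α) → Prop
  | _, [] => True
  | p, f :: F => (f ≠ [] ∧ (f.length = 1 ∨ f <:+: p)) ∧ FactorizesAfter (p ++ f) F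

theorem factorizesAfter_append {α : Type*} (p : List α) (A B : List (List α)) :
    FactorizesAfter p (A ++ B) ↔
      FactorizesAfter p A ∧ FactorizesAfter (p ++ A.flatten) B := by
  induction A generalizing p with
  | nil => simp [FactorizesAfter]
  | cons f A ih => simp [FactorizesAfter, ih, and_assoc]

theorem factorizesAfter_iff {α : Type*} (p : List α) (F : List (List α)) :
    FactorizesAfter p F ↔ ∀ (t : ℕ) (ht : t < F.length), F.get ⟨t, ht⟩ ≠ [] ∧
      ((F.get ⟨t, ht⟩).length = 1 ∨ F.get ⟨t, ht⟩ <:+: p ++ (F.take t).flatten) := by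
  induction F generalizing p with
  | nil => simp [FactorizesAfter]
  | cons f F ih =>
    simp only [FactorizesAfter, ih]
    constructor
    · rintro ⟨h0, h⟩ t ht
      cases t with
      | zero => simpa using h0
      | succ t => simpa using h t (by simpa using ht)
    · intro h
      refine ⟨by simpa using h 0 (by simp), fun t ht => ?_⟩
      simpa using h (t + 1) (by simpa using ht)

theorem isFactorization_iff {α : Type*} (w : List α) (F : List (List α)) :
    IsFactorization w F ↔ F.flatten = w ∧ FactorizesAfter [] F := by
  rw [factorizesAfter_iff]
  rfl

theorem factorizesAfter_of_isInfix {α : Type*} {p v : List α} {B : List (List α)}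
    (hv : v <:+: p) (hB : ∀ f ∈ B, f ≠ [] ∧ f <:+: v) : FactorizesAfter p B := by
  induction B generalizing p with
  | nil => trivial
  | cons f B ih =>
    have hf := hB f (by simp)
    exact ⟨⟨hf.1, Or.inr (hf.2.trans hv)⟩,
      ih (hv.trans (List.prefix_append p f).isInfix) fun g hg => hB g (by simp [hg])⟩

theorem drop_take_isInfix {α : Type*} {w v : List α} {s i k : ℕ}
    (hs : (w.drop s).take v.length = v) (hi : s ≤ i) (hk : i + k ≤ s + v.length) :
    (w.drop i).take k <:+: v := by
  have h : (w.drop i).take k = (v.drop (i - s)).take k := by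
    rw [← hs, List.drop_take, List.take_take, List.drop_drop]
    congr 1
    · omega
    · congr 1; omega
  rw [h]
  exact (List.take_prefix _ _).isInfix.trans (List.drop_suffix _ _).isInfix

/-- If the middle part of `w` is covered by occurrences of `v`, a block of length at most `|v|`
in it is a concatenation of at most two factors of `v`. -/
theorem exists_two_infixes {α : Type*} {w v : List α}
    (hc : ∀ q, v.length ≤ q → q + v.length ≤ w.length →
      ∃ s, s ≤ q ∧ q < s + v.length ∧ (w.drop s).take v.length = v)
    {i k : ℕ} (hi : v.length ≤ i) (hk : k ≤ v.length) (hw : i + k + v.length ≤ w.length) :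
    ∃ B : List (List α), B.flatten = (w.drop i).take k ∧ B.length ≤ 2 ∧ ∀ f ∈ B, f <:+: v := by
  classical
  obtain ⟨s₀, hs₀i, hs₀, hs₀v⟩ := hc i hi (by omega)
  set s := Nat.findGreatest (fun s => (w.drop s).take v.length = v) i with hsdef
  have hsv : (w.drop s).take v.length = v :=
    Nat.findGreatest_spec (P := fun s => (w.drop s).take v.length = v) hs₀i hs₀v
  have hsi : s ≤ i := Nat.findGreatest_le i
  have hs₀s : s₀ ≤ s :=
    Nat.le_findGreatest (P := fun s => (w.drop s).take v.length = v) hs₀i hs₀v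
  by_cases h1 : i + k ≤ s + v.length
  · exact ⟨[(w.drop i).take k], by simp, by simp, by simpa using drop_take_isInfix hsv hsi h1⟩
  obtain ⟨s', hs'1, hs'2, hs'v⟩ := hc (s + v.length) (by omega) (by omega)
  have hs'i : i < s' := by
    by_contra! h
    have := Nat.le_findGreatest (P := fun s => (w.drop s).take v.length = v) h hs'v
    omega
  obtain ⟨a, ha⟩ : ∃ a, s + v.length = i + a := ⟨s + v.length - i, by omega⟩
  refine ⟨[(w.drop i).take a, (w.drop (i + a)).take (k - a)], ?_, by simp, ?_⟩
  · have : k = a + (k - a) := by omega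
    rw [this, List.take_add]
    simp
  · have h1 := drop_take_isInfix (k := a) hsv hsi (by omega)
    have h2 := drop_take_isInfix (i := i + a) (k := k - a) hs'v (by omega) (by omega)
    simp [h1, h2]

theorem exists_infixes {α : Type*} {w v : List α}
    (hc : ∀ q, v.length ≤ q → q + v.length ≤ w.length →
      ∃ s, s ≤ q ∧ q < s + v.length ∧ (w.drop s).take v.length = v)
    (j : ℕ) {i k : ℕ} (hi : v.length ≤ i) (hk : k ≤ j * v.length)
    (hw : i + k + v.length ≤ w.length) :
    ∃ B : List (List α), B.flatten = (w.drop i).take k ∧ B.length ≤ 2 * j ∧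
      ∀ f ∈ B, f <:+: v := by
  induction j generalizing i k with
  | zero => exact ⟨[], by simp_all, by simp, by simp⟩
  | succ j ih =>
    rw [Nat.succ_mul] at hk
    obtain ⟨B, hB, hBl, hBv⟩ := exists_two_infixes hc hi (k := min k v.length)
      (by omega) (by omega)
    obtain ⟨C, hC, hCl, hCv⟩ := ih (i := i + min k v.length) (k := k - min k v.length)
      (by omega) (by omega) (by omega)
    refine ⟨B ++ C, ?_, by simp; omega, ?_⟩
    · rw [List.flatten_append, hB, hC, ← List.drop_drop, ← List.take_add]
      congr 1; omega
    · intro f hf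
      rcases List.mem_append.1 hf with h | h
      · exact hBv f h
      · exact hCv f h

theorem IsQuasiseed.covers {α : Type*} {v w : List α} (h : IsQuasiseed v w) {q : ℕ}
    (h1 : v.length ≤ q) (h2 : q + v.length ≤ w.length) :
    ∃ s, s ≤ q ∧ q < s + v.length ∧ (w.drop s).take v.length = v := by
  obtain ⟨-, x, y, z, rfl, hx, hz, hy⟩ := h
  simp only [List.length_append] at h2
  obtain ⟨p, ⟨hp1, hp2, hp⟩, hpq, hqp⟩ := hy (q - x.length + 1) (by omega) (by omega)
  refine ⟨x.length + (p - 1), by omega, by omega, ?_⟩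
  rw [List.append_assoc, ← List.drop_drop, List.drop_left,
    List.drop_append_of_le_length (by omega), List.take_append_of_le_length, hp]
  simp; omega

theorem IsQuasiseed.isInfix_of_isPrefix {α : Type*} {v w p : List α} (h : IsQuasiseed v w)
    (hw : 3 * v.length ≤ w.length) (hp : p <+: w) (hpl : 2 * v.length ≤ p.length) :
    v <:+: p := by
  obtain ⟨-, x, y, z, rfl, hx, hz, hy⟩ := h
  simp only [List.length_append] at hw
  obtain ⟨s, ⟨hs1, hs2, hs⟩, hsq, -⟩ := hy 1 le_rfl (by omega)
  obtain rfl : s = 1 := by omega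
  have hvy : v <+: y := by
    rw [← hs]
    simpa using List.take_prefix v.length y
  have hxv : x ++ v <+: x ++ y ++ z :=
    ((List.prefix_append_right_inj x).2 hvy).trans (List.prefix_append _ z)
  exact (List.suffix_append x v).isInfix.trans
    (List.prefix_of_prefix_length_le hxv hp (by simp; omega)).isInfix

theorem quasiseeds_factors {α : Type*} (w v : List α) (F : List (List α))
    (hF : IsFFactorization w F) (hq : IsQuasiseed v w) :
    NumFactorsIn F (2 * v.length + 1) (w.length - v.length) ≤ 2 * w.length / v.length := by
  have hm : 0 < v.length := by
    obtain ⟨-, x, y, z, -, hx, -⟩ := hq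
    omega
  obtain ⟨hfact, hmin⟩ := hF
  rw [isFactorization_iff] at hfact
  obtain ⟨hflat, hfact⟩ := hfact
  unfold NumFactorsIn
  set S := (Finset.range F.length).filter fun t =>
    2 * v.length + 1 ≤ (F.take t).flatten.length + 1 ∧
      (F.take (t + 1)).flatten.length ≤ w.length - v.length with hS
  rcases S.eq_empty_or_nonempty with hemp | hne
  · simp [hemp]
  have ha := S.min'_mem hne
  have hb := S.max'_mem hne
  have hab := S.min'_le _ hb
  have hcard : S.card ≤ S.max' hne + 1 - S.min' hne := by
    rw [← Nat.card_Icc]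
    exact Finset.card_le_card fun t ht =>
      Finset.mem_Icc.2 ⟨S.min'_le _ ht, S.le_max' _ ht⟩
  generalize S.min' hne = a at *
  generalize S.max' hne = b at *
  rw [hS, Finset.mem_filter, Finset.mem_range] at ha hb
  obtain ⟨c, rfl⟩ : ∃ c, b = a + c := ⟨b - a, by omega⟩
  obtain ⟨A, M, C, rfl, hA, hM⟩ : ∃ A M C, F = A ++ M ++ C ∧ A.length = a ∧
      M.length = c + 1 := by
    refine ⟨F.take a, (F.drop a).take (c + 1), F.drop (a + (c + 1)), ?_, ?_, ?_⟩
    · rw [← List.take_add, List.take_append_drop]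
    · simp; omega
    · simp; omega
  subst hA
  have hAt : (A ++ M ++ C).take A.length = A := by simp
  have hMt : (A ++ M ++ C).take (A.length + c + 1) = A ++ M :=
    List.take_left' (by simp; omega)
  rw [hAt] at ha
  rw [hMt] at hb
  have hlo : 2 * v.length ≤ A.flatten.length := by omega
  have hhi := hb.2.2
  have hlen : w.length = A.flatten.length + M.flatten.length + C.flatten.length := by
    simp only [← hflat, List.flatten_append, List.length_append]
  simp only [List.flatten_append, List.length_append] at hhi hflat
  have hMw : (w.drop A.flatten.length).take M.flatten.length = M.flatten := by
    rw [← hflat, List.append_assoc, List.drop_left, List.take_left]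
  have hvA : v <:+: A.flatten := hq.isInfix_of_isPrefix (by omega)
    ⟨M.flatten ++ C.flatten, by rw [← hflat, List.append_assoc]⟩ hlo
  obtain ⟨B, hBf, hBl, hBv⟩ := exists_infixes (fun q h1 h2 => hq.covers h1 h2)
    (M.flatten.length / v.length + 1) (i := A.flatten.length) (k := M.flatten.length)
    (by omega)
    (by rw [mul_comm]; exact (Nat.lt_mul_div_succ _ hm).le) (by omega)
  rw [hMw] at hBf
  have hB'f : (B.filter fun f => !f.isEmpty).flatten = M.flatten := by
    rw [List.flatten_filter_not_isEmpty, hBf]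
  have hB'l := List.length_filter_le (fun f => !f.isEmpty) B
  have hle := hmin (A ++ (B.filter fun f => !f.isEmpty) ++ C) <| by
    rw [isFactorization_iff]
    refine ⟨by simpa [hB'f] using hflat, ?_⟩
    simp only [factorizesAfter_append, List.flatten_append, List.nil_append] at hfact ⊢
    refine ⟨⟨hfact.1.1, factorizesAfter_of_isInfix hvA fun f hf => ?_⟩, by
      rw [hB'f]; exact hfact.2⟩
    rw [List.mem_filter] at hf
    exact ⟨by simpa using hf.2, hBv f hf.1⟩
  simp only [List.length_append] at hle
  have hcount : S.card ≤ 2 * (M.flatten.length / v.length + 1) := by omega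
  rw [Nat.le_div_iff_mul_le hm]
  calc S.card * v.length
      ≤ 2 * (M.flatten.length / v.length + 1) * v.length := Nat.mul_le_mul_right _ hcount
    _ = 2 * (M.flatten.length / v.length * v.length) + 2 * v.length := by ring
    _ ≤ 2 * w.length := by
      have := Nat.div_mul_le_self M.flatten.length v.length
      omega
end

section
/- Let u and u' be nonempty factors of w such that the set of starting positions of occurrences of u in w equals the set of starting positions of occurrences of u' in w, and |u| ≤ |u'|. If u is a quasiseed of w, then u' is a quasiseed of w. -/
theorem occursAt_append_iff {α : Type*} (x y z v : List α) {p : ℕ} (hp : 1 ≤ p)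
    (hpv : p + v.length ≤ y.length + 1) :
    OccursAt (x ++ y ++ z) v (x.length + p) ↔ OccursAt y v p := by
  have h : ((x ++ y ++ z).drop (x.length + p - 1)).take v.length
      = (y.drop (p - 1)).take v.length := by
    rw [List.append_assoc, show x.length + p - 1 = x.length + (p - 1) by omega,
      List.drop_append, List.drop_eq_nil_of_le (by omega), List.nil_append,
      Nat.add_sub_cancel_left, List.drop_append_of_le_length (by omega),
      List.take_append_of_le_length (by rw [List.length_drop]; omega)]
  unfold OccursAt
  rw [h]
  simp only [List.length_append]
  constructor
  · rintro ⟨-, -, h⟩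
    exact ⟨hp, hpv, h⟩
  · rintro ⟨-, -, h⟩
    exact ⟨by omega, by omega, h⟩

theorem quasiseed_of_equivalent_longer {α : Type*} (w u u' : List α)
    (hu : u ≠ []) (hu' : u' ≠ [])
    (hfu : ∃ x z, w = x ++ u ++ z) (hfu' : ∃ x z, w = x ++ u' ++ z)
    (hocc : {p : ℕ | OccursAt w u p} = {p : ℕ | OccursAt w u' p})
    (hlen : u.length ≤ u'.length) (hq : IsQuasiseed u w) :
    IsQuasiseed u' w := by
  refine ⟨hfu', ?_⟩
  obtain ⟨-, x, y, z, hw, hx, hz, hc⟩ := hq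
  have hwl : w.length = x.length + y.length + z.length := by simp [hw]; omega
  have occ : ∀ p, OccursAt y u p → OccursAt w u' (x.length + p) := by
    intro p hp
    have h : OccursAt w u (x.length + p) := by
      rw [hw]
      exact (occursAt_append_iff x y z u hp.1 hp.2.1).2 hp
    exact (Set.ext_iff.1 hocc _).1 h
  rcases Nat.eq_zero_or_pos y.length with hy | hy
  · obtain ⟨x', z', hw'⟩ := hfu'
    have hwl' : w.length = x'.length + u'.length + z'.length := by simp [hw']; omega
    refine ⟨x', u', z', hw', by omega, by omega, fun q hq1 hq2 => ⟨1, ?_, hq1, by omega⟩⟩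
    exact ⟨le_rfl, by omega, by simp⟩
  · obtain ⟨b, hb, hb1, hb2⟩ := hc y.length hy le_rfl
    have hbu := hb.2.1
    have hb0 := hb.1
    have hbw := (occ b hb).2.1
    obtain ⟨y', z', hw', hy'⟩ : ∃ y' z', w = x ++ y' ++ z' ∧
        y'.length = b - 1 + u'.length := by
      refine ⟨(y ++ z).take (b - 1 + u'.length), (y ++ z).drop (b - 1 + u'.length), ?_, ?_⟩
      · rw [List.append_assoc, List.take_append_drop, hw, List.append_assoc]
      · rw [List.length_take, List.length_append]
        omega
    have hwl' : w.length = x.length + y'.length + z'.length := by simp [hw']; omega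
    have occ' : ∀ p, OccursAt y u p → OccursAt y' u' p := by
      intro p hp
      have h1 := hp.2.1
      have h := occ p hp
      rw [hw'] at h
      exact (occursAt_append_iff x y' z' u' hp.1 (by omega)).1 h
    refine ⟨x, y', z', hw', by omega, by omega, fun q hq1 hq2 => ?_⟩
    rcases le_or_gt q y.length with hqy | hqy
    · obtain ⟨p, hp, hp1, hp2⟩ := hc q hq1 hqy
      exact ⟨p, occ' p hp, hp1, by omega⟩
    · exact ⟨b, occ' b hb, by omega, by omega⟩
end
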